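/- arXiv:2406.07575 — 3 statements merged into one kernel-verified Lean document; each statement's English description precedes it below -/
import Mathlib

section
/- For every integer n > 1: (i) if d is a primitive divisor of n² + 1, then d is a prime number; and (ii) if d₁ and d₂ are both primitive divisors of n² + 1, then d₁ = d₂ (the primitive divisor, when it exists, is unique). -/
/-- `d` is a primitive divisor of `n² + 1`. -/
def IsPrimitiveDivisor (d n : ℕ) : Prop :=
  1 < d ∧ d ∣ n ^ 2 + 1 ∧ ∀ m : ℕ, 1 ≤ m → m < n → Nat.gcd d (m ^ 2 + 1) = 1

namespace IsPrimitiveDivisor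

theorem of_dvd {d e n : ℕ} (h : IsPrimitiveDivisor d n) (he : 1 < e) (hed : e ∣ d) :
    IsPrimitiveDivisor e n :=
  ⟨he, hed.trans h.2.1, fun m h1 hm => Nat.Coprime.coprime_dvd_left hed (h.2.2 m h1 hm)⟩

theorem le_of_dvd {d n m : ℕ} (h : IsPrimitiveDivisor d n) (hm : 1 ≤ m)
    (hd : d ∣ m ^ 2 + 1) : n ≤ m := by
  by_contra! hlt
  have := h.2.2 m hm hlt
  rw [Nat.gcd_eq_left hd] at this
  exact h.1.ne' this

theorem two_mul_le {d n : ℕ} (h : IsPrimitiveDivisor d n) : 2 * n ≤ d := by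
  have hd : 0 < d := zero_lt_one.trans h.1
  have hmod : d ∣ (n % d) ^ 2 + 1 :=
    (((Nat.mod_modEq n d).pow 2).add_right 1).dvd_iff dvd_rfl |>.mpr h.2.1
  have hpos : 1 ≤ n % d := by
    by_contra! h0
    rw [Nat.lt_one_iff.mp h0] at hmod
    exact h.1.ne' (Nat.dvd_one.mp hmod)
  have hlt : n < d := (h.le_of_dvd hpos hmod).trans_lt (Nat.mod_lt n hd)
  obtain ⟨m, rfl⟩ := Nat.exists_eq_add_of_lt hlt
  have hm : n + m + 1 ∣ (m + 1) ^ 2 + 1 := by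
    zify
    have hn : ((n : ℤ) + m + 1) ∣ (n : ℤ) ^ 2 + 1 := mod_cast h.2.1
    have hs : ((n : ℤ) + m + 1) ∣ ((n : ℤ) + m + 1) * (m + 1 - n) := dvd_mul_right _ _
    have heq : ((m : ℤ) + 1) ^ 2 + 1 = (n ^ 2 + 1) + (n + m + 1) * (m + 1 - n) := by ring
    exact heq ▸ dvd_add hn hs
  have := h.le_of_dvd (Nat.le_add_left 1 m) hm
  omega

theorem not_mul_dvd {a b n : ℕ} (hn : 1 < n) (ha : IsPrimitiveDivisor a n)
    (hb : IsPrimitiveDivisor b n) : ¬a * b ∣ n ^ 2 + 1 := by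
  intro hab
  have hle := Nat.le_of_dvd (Nat.succ_pos _) hab
  have hmul := Nat.mul_le_mul ha.two_mul_le hb.two_mul_le
  nlinarith

protected theorem prime {d n : ℕ} (hn : 1 < n) (h : IsPrimitiveDivisor d n) : d.Prime := by
  by_contra hd
  obtain ⟨a, b, ha, hb, rfl⟩ := (Nat.not_prime_iff_exists_mul_eq h.1).mp hd
  have ha1 : 1 < a := by nlinarith
  have hb1 : 1 < b := by nlinarith
  exact not_mul_dvd hn (h.of_dvd ha1 (dvd_mul_right a b)) (h.of_dvd hb1 (dvd_mul_left b a)) h.2.1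

theorem unique {d₁ d₂ n : ℕ} (hn : 1 < n) (h₁ : IsPrimitiveDivisor d₁ n)
    (h₂ : IsPrimitiveDivisor d₂ n) : d₁ = d₂ := by
  by_contra hne
  have hcop : d₁.Coprime d₂ := (Nat.coprime_primes (h₁.prime hn) (h₂.prime hn)).mpr hne
  exact not_mul_dvd hn h₁ h₂ (hcop.mul_dvd_of_dvd_of_dvd h₁.2.1 h₂.2.1)

end IsPrimitiveDivisor

theorem stmt_3 (n : ℕ) (hn : 1 < n) :
    (∀ d : ℕ, IsPrimitiveDivisor d n → d.Prime) ∧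
      (∀ d₁ d₂ : ℕ, IsPrimitiveDivisor d₁ n → IsPrimitiveDivisor d₂ n → d₁ = d₂) :=
  ⟨fun _ h => h.prime hn, fun _ _ h₁ h₂ => h₁.unique hn h₂⟩
end

section
/- There are infinitely many integers n > 1 such that n² + 1 does not have a primitive divisor; that is, for every N there exists n > N such that every integer d > 1 dividing n² + 1 satisfies gcd(d, m² + 1) > 1 for some integer m with 1 ≤ m < n. -/
/-- A prime divisor `p < 2 * n` of `n ^ 2 + 1` already divides some smaller `m ^ 2 + 1`. -/
theorem exists_lt_dvd_sq_add_one {n p : ℕ} (hp : p.Prime) (hpn : p ∣ n ^ 2 + 1)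
    (hlt : p < 2 * n) : ∃ m : ℕ, 1 ≤ m ∧ m < n ∧ p ∣ m ^ 2 + 1 := by
  rcases le_or_gt p n with h | h
  · refine ⟨n % p, ?_, (Nat.mod_lt n hp.pos).trans_le h, ?_⟩
    · rw [Nat.one_le_iff_ne_zero]
      intro h0
      have hn : p ∣ n ^ 2 := dvd_pow (Nat.dvd_of_mod_eq_zero h0) two_ne_zero
      exact hp.one_lt.ne' (Nat.dvd_one.mp ((Nat.dvd_add_right hn).mp hpn))
    · exact (((Nat.mod_modEq n p).pow 2).add_right 1).dvd_iff dvd_rfl |>.mpr hpn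
  · obtain ⟨m, rfl⟩ := Nat.exists_eq_add_of_lt h
    refine ⟨m + 1, by lia, by lia, ?_⟩
    zify at hpn ⊢
    have hdiff : (m + 1 : ℤ) ^ 2 + 1 = (n ^ 2 + 1) + (n + m + 1) * (m + 1 - n) := by ring
    rw [hdiff]
    exact dvd_add hpn (dvd_mul_right _ _)

/-- Every prime divisor of `(2 * k ^ 2) ^ 2 + 1` is small, by the factorization
`4 * k ^ 4 + 1 = (2 * k ^ 2 + 2 * k + 1) * (2 * k ^ 2 - 2 * k + 1)`. -/
theorem prime_dvd_four_mul_pow_four_add_one_lt {k p : ℕ} (hk : 2 ≤ k) (hp : p.Prime)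
    (h : p ∣ (2 * k ^ 2) ^ 2 + 1) : p < 2 * (2 * k ^ 2) := by
  obtain ⟨j, rfl⟩ := Nat.exists_eq_add_of_le hk
  have hfac : (2 * (2 + j) ^ 2) ^ 2 + 1
      = (2 * (2 + j) ^ 2 + 2 * (2 + j) + 1) * (2 * (2 + j) * (1 + j) + 1) := by ring
  rw [hfac] at h
  rcases hp.dvd_mul.mp h with h | h <;>
    nlinarith [Nat.le_of_dvd (Nat.succ_pos _) h]

theorem stmt_4 :
    ∀ N : ℕ, ∃ n : ℕ, n > N ∧ 1 < n ∧
      ∀ d : ℕ, 1 < d → d ∣ n ^ 2 + 1 →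
        ∃ m : ℕ, 1 ≤ m ∧ m < n ∧ 1 < Nat.gcd d (m ^ 2 + 1) := by
  intro N
  refine ⟨2 * (N + 2) ^ 2, by nlinarith, ?_, fun d hd hdn => ?_⟩
  · have := Nat.one_le_pow 2 (N + 2) (by lia)
    lia
  have hp : d.minFac.Prime := Nat.minFac_prime hd.ne'
  have hpn := d.minFac_dvd.trans hdn
  obtain ⟨m, hm, hmn, hpm⟩ := exists_lt_dvd_sq_add_one hp hpn
    (prime_dvd_four_mul_pow_four_add_one_lt (by lia) hp hpn)
  exact ⟨m, hm, hmn, hp.one_lt.trans_le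
    (Nat.le_of_dvd (Nat.gcd_pos_of_pos_left _ (by lia)) (Nat.dvd_gcd d.minFac_dvd hpm))⟩
end

section
/- There exists a constant C > 0 such that for all sufficiently large x, ρ(x) < x − C·x/log x, where ρ(x) is the number of integers 1 < n ≤ x for which n² + 1 has a primitive divisor. -/
open scoped Classical

/-- The number of integers `1 < n ≤ x` such that `n² + 1` has a primitive divisor. -/
noncomputable def rho (x : ℝ) : ℕ :=
  ((Finset.Icc 2 ⌊x⌋₊).filter fun n => ∃ d : ℕ, IsPrimitiveDivisor d n).card

open ArithmeticFunction in
theorem sum_log_eq_sum_vonMangoldt_mul_div (N : ℕ) :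
    ∑ n ∈ Finset.Ioc 0 N, Real.log n = ∑ d ∈ Finset.Ioc 0 N, Λ d * ((N / d : ℕ) : ℝ) := by
  rw [← sum_Ioc_mul_zeta_eq_sum, vonMangoldt_mul_zeta]
  rfl

theorem sum_log_eq_log_factorial (N : ℕ) :
    ∑ n ∈ Finset.Ioc 0 N, Real.log n = Real.log N.factorial := by
  induction N with
  | zero => simp
  | succ k ih =>
    rw [Finset.sum_Ioc_succ_top (Nat.zero_le k), ih, Nat.factorial_succ, Nat.cast_mul,
      Real.log_mul (by positivity) (by positivity), add_comm]

theorem mul_log_sub_le_log_factorial (N : ℕ) :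
    N * Real.log N - N ≤ Real.log N.factorial := by
  rcases Nat.eq_zero_or_pos N with rfl | hN
  · simp
  have h := Real.pow_div_factorial_le_exp (x := (N : ℝ)) (by positivity) N
  have h' := Real.log_le_log (by positivity) h
  rw [Real.log_exp, Real.log_div (by positivity) (by positivity), Real.log_pow] at h'
  linarith

theorem log_factorial_le_mul_log (N : ℕ) : Real.log N.factorial ≤ N * Real.log N := by
  have h : (N.factorial : ℝ) ≤ (N : ℝ) ^ N := mod_cast Nat.factorial_le_pow N
  simpa using Real.log_le_log (by positivity) h

open scoped ArithmeticFunction.vonMangoldt in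
theorem log_sub_one_le_sum_vonMangoldt_div {N : ℕ} (hN : 0 < N) :
    Real.log N - 1 ≤ ∑ d ∈ Finset.Ioc 0 N, Λ d / d := by
  have hN' : (0 : ℝ) < N := by exact_mod_cast hN
  have h : Real.log N.factorial ≤ N * ∑ d ∈ Finset.Ioc 0 N, Λ d / d := by
    rw [← sum_log_eq_log_factorial, sum_log_eq_sum_vonMangoldt_mul_div, Finset.mul_sum]
    refine Finset.sum_le_sum fun d _ => ?_
    have := mul_le_mul_of_nonneg_left (Nat.cast_div_le (α := ℝ) (m := N) (n := d))
      (ArithmeticFunction.vonMangoldt_nonneg (n := d))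
    calc Λ d * ((N / d : ℕ) : ℝ) ≤ Λ d * (N / d) := this
      _ = N * (Λ d / d) := by ring
  have h2 := mul_log_sub_le_log_factorial N
  refine le_of_mul_le_mul_left ?_ hN'
  linarith

open scoped ArithmeticFunction.vonMangoldt in
theorem sum_vonMangoldt_le (N : ℕ) :
    ∑ d ∈ Finset.Ioc 0 N, Λ d ≤ (Real.log 4 + 4) * N := by
  simpa [Chebyshev.psi] using Chebyshev.psi_le_const_mul_self (x := (N : ℝ)) (by positivity)

open scoped ArithmeticFunction.vonMangoldt in
theorem sum_vonMangoldt_div_le {N : ℕ} (hN : 0 < N) :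
    ∑ d ∈ Finset.Ioc 0 N, Λ d / d ≤ Real.log N + (Real.log 4 + 4) := by
  have hN' : (0 : ℝ) < N := by exact_mod_cast hN
  have h : N * ∑ d ∈ Finset.Ioc 0 N, Λ d / d ≤
      Real.log N.factorial + ∑ d ∈ Finset.Ioc 0 N, Λ d := by
    rw [← sum_log_eq_log_factorial, sum_log_eq_sum_vonMangoldt_mul_div, Finset.mul_sum,
      ← Finset.sum_add_distrib]
    refine Finset.sum_le_sum fun d hd => ?_
    have hd0 : (0 : ℝ) < d := by exact_mod_cast (Finset.mem_Ioc.1 hd).1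
    have hlt : (N : ℝ) ≤ d * ((N / d : ℕ) + 1) := by
      exact_mod_cast (Nat.lt_mul_div_succ N (Finset.mem_Ioc.1 hd).1).le
    have h3 : (N : ℝ) / d ≤ (N / d : ℕ) + 1 := by rw [div_le_iff₀' hd0]; exact hlt
    have := mul_le_mul_of_nonneg_left h3 (ArithmeticFunction.vonMangoldt_nonneg (n := d))
    calc N * (Λ d / d) = Λ d * (N / d) := by ring
      _ ≤ Λ d * ((N / d : ℕ) + 1) := this
      _ = _ := by ring
  have h2 := log_factorial_le_mul_log N
  have h3 := sum_vonMangoldt_le N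
  refine le_of_mul_le_mul_left ?_ hN'
  linarith

/-- The nontrivial Dirichlet character modulo `4`, with real values. -/
noncomputable def chiFour (n : ℕ) : ℝ := ((ZMod.χ₄ (n : ZMod 4) : ℤ) : ℝ)

theorem chiFour_mul (m n : ℕ) : chiFour (m * n) = chiFour m * chiFour n := by
  simp only [chiFour, Nat.cast_mul, map_mul, Int.cast_mul]

theorem chiFour_one : chiFour 1 = 1 := by simp [chiFour]

theorem chiFour_two : chiFour 2 = 0 := by
  simp [chiFour]

theorem chiFour_of_mod_four_eq_three {n : ℕ} (hn : n % 4 = 3) : chiFour n = -1 := by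
  simp [chiFour, ZMod.χ₄_nat_three_mod_four hn]

theorem abs_chiFour_le_one (n : ℕ) : |chiFour n| ≤ 1 := by
  unfold chiFour
  rw [ZMod.χ₄_nat_eq_if_mod_four]
  split_ifs <;> simp

theorem sum_range_chiFour (N : ℕ) :
    ∑ n ∈ Finset.range N, chiFour n = if N % 4 = 2 ∨ N % 4 = 3 then 1 else 0 := by
  induction N with
  | zero => simp
  | succ k ih =>
    rw [Finset.sum_range_succ, ih, chiFour, ZMod.χ₄_nat_eq_if_mod_four]
    have : k % 4 < 4 := Nat.mod_lt _ (by norm_num)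
    obtain h | h | h | h : k % 4 = 0 ∨ k % 4 = 1 ∨ k % 4 = 2 ∨ k % 4 = 3 := by omega
    all_goals
      have h2 : (k + 1) % 4 = (k % 4 + 1) % 4 := by omega
      have h3 : k % 2 = k % 4 % 2 := by omega
      simp [h2, h3, h]

theorem abs_sum_Ioc_chiFour_le_one {M N : ℕ} (h : M ≤ N) :
    |∑ n ∈ Finset.Ioc M N, chiFour n| ≤ 1 := by
  have e : ∑ n ∈ Finset.Ioc M N, chiFour n =
      ∑ n ∈ Finset.range (N + 1), chiFour n - ∑ n ∈ Finset.range (M + 1), chiFour n := by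
    rw [← Finset.sum_Ico_eq_sub _ (by omega)]
    refine Finset.sum_congr ?_ fun _ _ => rfl
    ext n
    simp only [Finset.mem_Ioc, Finset.mem_Ico]
    omega
  rw [e, sum_range_chiFour, sum_range_chiFour]
  split_ifs <;> simp

theorem abs_sum_chiFour_mul_le {a : ℕ → ℝ} {M N : ℕ} (ha : ∀ n, 0 ≤ a n)
    (hanti : ∀ n, M < n → a (n + 1) ≤ a n) (h : M < N) :
    |∑ n ∈ Finset.Ioc M N, chiFour n * a n| ≤ a (M + 1) := by
  have key : |∑ n ∈ Finset.Ioc M N, chiFour n * a n - (∑ n ∈ Finset.Ioc M N, chiFour n) * a N|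
      ≤ a (M + 1) - a N := by
    induction N, Nat.succ_le_of_lt h using Nat.le_induction with
    | base => simp
    | succ k hk ih =>
      have hk' : M < k := hk
      rw [Finset.sum_Ioc_succ_top hk'.le, Finset.sum_Ioc_succ_top hk'.le]
      set P := ∑ n ∈ Finset.Ioc M k, chiFour n * a n
      set X := ∑ n ∈ Finset.Ioc M k, chiFour n with hX
      have e : P + chiFour (k + 1) * a (k + 1) - (X + chiFour (k + 1)) * a (k + 1) =
        (P - X * a k) + X * (a k - a (k + 1)) := by ring
      have h1 : |X * (a k - a (k + 1))| ≤ a k - a (k + 1) := by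
        rw [abs_mul, abs_of_nonneg (sub_nonneg.2 (hanti k hk'))]
        exact mul_le_of_le_one_left (sub_nonneg.2 (hanti k hk'))
          (abs_sum_Ioc_chiFour_le_one hk'.le)
      rw [e]
      linarith [abs_add_le (P - X * a k) (X * (a k - a (k + 1))), ih hk']
  have h2 : |(∑ n ∈ Finset.Ioc M N, chiFour n) * a N| ≤ a N := by
    rw [abs_mul, abs_of_nonneg (ha N)]
    exact mul_le_of_le_one_left (ha N) (abs_sum_Ioc_chiFour_le_one h.le)
  rw [abs_le] at *
  constructor <;> linarith

theorem abs_sum_chiFour_div_le (M N : ℕ) :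
    |∑ n ∈ Finset.Ioc M N, chiFour n / n| ≤ 1 / (M + 1) := by
  rcases lt_or_ge M N with h | h
  · have := abs_sum_chiFour_mul_le (a := fun n => 1 / (n : ℝ)) (fun n => by positivity)
      (fun n hn => by
        have : (0 : ℝ) < n := by exact_mod_cast (Nat.zero_le M).trans_lt hn
        push_cast
        gcongr
        linarith) h
    simpa [div_eq_mul_inv] using this
  · rw [Finset.Ioc_eq_empty_of_le h]
    simp only [Finset.sum_empty, abs_zero]
    positivity

theorem two_thirds_le_sum_chiFour_div {N : ℕ} (hN : 0 < N) :
    2 / 3 ≤ ∑ n ∈ Finset.Ioc 0 N, chiFour n / n := by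
  obtain rfl | h : N = 1 ∨ 2 ≤ N := by omega
  · rw [Finset.sum_Ioc_succ_top le_rfl]
    simp [chiFour_one]
    norm_num
  · rw [← Finset.sum_Ioc_consecutive _ (Nat.zero_le 2) h]
    have h1 := abs_le.1 (abs_sum_chiFour_div_le 2 N)
    have h2 : ∑ n ∈ Finset.Ioc 0 2, chiFour n / n = 1 := by
      rw [Finset.sum_Ioc_succ_top (by norm_num), Finset.sum_Ioc_succ_top le_rfl]
      simp [chiFour_one, chiFour_two]
    rw [h2]
    norm_num at h1
    linarith [h1.1]

theorem abs_sum_chiFour_mul_log_div_le (N : ℕ) :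
    |∑ n ∈ Finset.Ioc 0 N, chiFour n * (Real.log n / n)| ≤ 1 := by
  have h2 : ∀ K ≤ 2, ∑ n ∈ Finset.Ioc 0 K, chiFour n * (Real.log n / n) = 0 := by
    intro K hK
    refine Finset.sum_eq_zero fun n hn => ?_
    obtain rfl | rfl : n = 1 ∨ n = 2 := by
      have := Finset.mem_Ioc.1 hn
      omega
    · simp
    · simp [chiFour_two]
  rcases le_or_gt N 2 with h | h
  · simp [h2 N h]
  · rw [← Finset.sum_Ioc_consecutive _ (Nat.zero_le 2) h.le, h2 2 le_rfl, zero_add]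
    refine (abs_sum_chiFour_mul_le (a := fun n => Real.log n / n)
      (fun n => div_nonneg (Real.log_natCast_nonneg n) n.cast_nonneg) (fun n hn => ?_) h).trans ?_
    · have h3 : (3 : ℝ) ≤ n := by exact_mod_cast hn
      have he := Real.exp_one_lt_d9
      refine Real.log_div_self_antitoneOn ?_ ?_ ?_
      · simp only [Set.mem_Ici]; linarith
      · simp only [Set.mem_Ici]; push_cast; linarith
      · push_cast; linarith
    · have := Real.log_le_sub_one_of_pos (x := 3) (by norm_num)
      norm_num
      linarith

open scoped ArithmeticFunction.vonMangoldt in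
theorem sum_chiFour_mul_log_div_eq (N : ℕ) :
    ∑ n ∈ Finset.Ioc 0 N, chiFour n * (Real.log n / n) =
      ∑ d ∈ Finset.Ioc 0 N, chiFour d * Λ d / d *
        ∑ m ∈ Finset.Ioc 0 (N / d), chiFour m / m := by
  let f : ArithmeticFunction ℝ := ⟨fun n => chiFour n * Λ n / n, by simp⟩
  let g : ArithmeticFunction ℝ := ⟨fun n => chiFour n / n, by simp⟩
  have h := ArithmeticFunction.sum_Ioc_mul_eq_sum_sum f g N
  refine Eq.trans ?_ h
  refine Finset.sum_congr rfl fun n hn => ?_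
  rw [ArithmeticFunction.mul_apply, ← ArithmeticFunction.vonMangoldt_sum,
    ← Nat.sum_divisorsAntidiagonal fun i _ => Λ i, Finset.sum_div, Finset.mul_sum]
  refine Finset.sum_congr rfl fun x hx => ?_
  have hx' := (Nat.mem_divisorsAntidiagonal.1 hx).1
  change chiFour n * (Λ x.1 / n) = chiFour x.1 * Λ x.1 / x.1 * (chiFour x.2 / x.2)
  rw [← hx', chiFour_mul, Nat.cast_mul, div_mul_div_comm]
  ring

open scoped ArithmeticFunction.vonMangoldt in
theorem abs_sum_chiFour_mul_vonMangoldt_div_le {N : ℕ} (hN : 0 < N) :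
    |∑ d ∈ Finset.Ioc 0 N, chiFour d * Λ d / d| ≤ 3 / 2 * (Real.log 4 + 5) := by
  have hN' : (0 : ℝ) < N := by exact_mod_cast hN
  set B := ∑ d ∈ Finset.Ioc 0 N, chiFour d * Λ d / d with hB
  set L := ∑ m ∈ Finset.Ioc 0 N, chiFour m / m with hL
  have hdiff : |B * L - ∑ n ∈ Finset.Ioc 0 N, chiFour n * (Real.log n / n)| ≤
      Real.log 4 + 4 := by
    rw [sum_chiFour_mul_log_div_eq, hB, Finset.sum_mul, ← Finset.sum_sub_distrib]
    refine (Finset.abs_sum_le_sum_abs _ _).trans ?_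
    have h1 : ∀ d ∈ Finset.Ioc 0 N, |chiFour d * Λ d / d * L - chiFour d * Λ d / d *
        ∑ m ∈ Finset.Ioc 0 (N / d), chiFour m / m| ≤ Λ d / N := by
      intro d hd
      have hdpos := (Finset.mem_Ioc.1 hd).1
      have hd0 : (0 : ℝ) < d := by exact_mod_cast hdpos
      have hΛ := ArithmeticFunction.vonMangoldt_nonneg (n := d)
      rw [← mul_sub, hL, ← Finset.sum_Ioc_consecutive _ (Nat.zero_le _) (Nat.div_le_self N d),
        add_sub_cancel_left, abs_mul, abs_div, abs_mul, abs_of_nonneg hΛ, abs_of_pos hd0]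
      have hlt : (N : ℝ) ≤ d * ((N / d : ℕ) + 1) := by
        exact_mod_cast (Nat.lt_mul_div_succ N hdpos).le
      have h3 : 1 / (((N / d : ℕ) : ℝ) + 1) ≤ d / N := by
        rw [div_le_div_iff₀ (by positivity) hN']
        linarith
      calc _ ≤ 1 * Λ d / d * (d / N) := by
            gcongr
            · exact abs_chiFour_le_one d
            · exact (abs_sum_chiFour_div_le _ _).trans h3
        _ = Λ d / N := by field_simp
    refine (Finset.sum_le_sum h1).trans ?_
    rw [← Finset.sum_div, div_le_iff₀ hN']
    exact sum_vonMangoldt_le N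
  have hT := abs_sum_chiFour_mul_log_div_le N
  have hBL : |B| * L ≤ Real.log 4 + 5 := by
    have hLpos : 0 ≤ L := by linarith [two_thirds_le_sum_chiFour_div hN]
    have e : |B| * L = |B * L| := by rw [abs_mul, abs_of_nonneg hLpos]
    rw [e]
    rw [abs_le] at *
    constructor <;> linarith
  have := mul_le_mul_of_nonneg_left (two_thirds_le_sum_chiFour_div hN) (abs_nonneg B)
  linarith

open scoped ArithmeticFunction.vonMangoldt in
/-- A Mertens-type lower bound for prime powers congruent to `1` modulo `4`. -/
theorem log_div_sub_le_sum_one_add_chiFour {M N : ℕ} (hM : 0 < M) (hMN : M ≤ N) :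
    Real.log (N / M) - (4 * Real.log 4 + 20) ≤
      ∑ d ∈ Finset.Ioc M N, (1 + chiFour d) * Λ d / d := by
  have hN : 0 < N := hM.trans_le hMN
  have e : ∑ d ∈ Finset.Ioc M N, (1 + chiFour d) * Λ d / d =
      (∑ d ∈ Finset.Ioc 0 N, Λ d / d - ∑ d ∈ Finset.Ioc 0 M, Λ d / d) +
      (∑ d ∈ Finset.Ioc 0 N, chiFour d * Λ d / d -
        ∑ d ∈ Finset.Ioc 0 M, chiFour d * Λ d / d) := by
    rw [← Finset.sum_Ioc_consecutive (fun d : ℕ => Λ d / d) (Nat.zero_le M) hMN,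
      ← Finset.sum_Ioc_consecutive (fun d : ℕ => chiFour d * Λ d / d) (Nat.zero_le M) hMN,
      add_sub_cancel_left, add_sub_cancel_left, ← Finset.sum_add_distrib]
    refine Finset.sum_congr rfl fun d _ => ?_
    ring
  rw [e, Real.log_div (by positivity) (by positivity)]
  have h1 := log_sub_one_le_sum_vonMangoldt_div hN
  have h2 := sum_vonMangoldt_div_le hM
  have h3 := (abs_le.1 (abs_sum_chiFour_mul_vonMangoldt_div_le hN)).1
  have h4 := (abs_le.1 (abs_sum_chiFour_mul_vonMangoldt_div_le hM)).2
  linarith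

open scoped ArithmeticFunction.vonMangoldt in
theorem sum_one_add_chiFour_le {K N : ℕ} (hK : 0 < K) (hN : 2 * K ≤ N) :
    ∑ d ∈ Finset.Ioc (N / K) N, (1 + chiFour d) * Λ d / d ≤
      2 * K / N * ((((Finset.Icc 1 N).filter fun p => p.Prime ∧ p % 4 = 1).card : ℝ) *
        Real.log N + 2 * √N * Real.log N) := by
  have hNpos : 0 < N := by omega
  have hN' : (0 : ℝ) < N := by exact_mod_cast hNpos
  have hK' : (0 : ℝ) < K := by exact_mod_cast hK
  set w : ℕ → ℝ := fun d => (if d.Prime ∧ d % 4 = 1 then Real.log N else 0) +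
    (if ¬ d.Prime then Λ d else 0) with hw
  have hw0 : ∀ d, 0 ≤ w d := fun d => by
    have := ArithmeticFunction.vonMangoldt_nonneg (n := d)
    have := Real.log_natCast_nonneg N
    simp only [hw]
    split_ifs <;> linarith
  have hterm : ∀ d ∈ Finset.Ioc (N / K) N, (1 + chiFour d) * Λ d / d ≤ 2 * K / N * w d := by
    intro d hd
    rw [Finset.mem_Ioc] at hd
    have hd2 : 2 < d := lt_of_le_of_lt ((Nat.le_div_iff_mul_le hK).2 hN) hd.1
    have hd0 : (0 : ℝ) < d := by exact_mod_cast (by omega : 0 < d)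
    have hΛ := ArithmeticFunction.vonMangoldt_nonneg (n := d)
    have hNd : (N : ℝ) ≤ K * d := by
      have := (Nat.div_lt_iff_lt_mul hK).1 hd.1
      rw [mul_comm] at this
      exact_mod_cast this.le
    have hinv : (1 : ℝ) / d ≤ K / N := by
      rw [div_le_div_iff₀ hd0 hN']
      linarith
    have hmain : (1 + chiFour d) * Λ d ≤ 2 * w d := by
      by_cases hp : d.Prime
      · by_cases h1 : d % 4 = 1
        · have hlog : Λ d ≤ Real.log N := by
            rw [ArithmeticFunction.vonMangoldt_apply_prime hp]
            exact Real.log_le_log hd0 (by exact_mod_cast hd.2)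
          have hc := (abs_le.1 (abs_chiFour_le_one d)).2
          simp only [hw, hp, h1]
          norm_num
          nlinarith
        · have h3 : d % 4 = 3 := by
            have := hp.eq_two_or_odd
            omega
          simp [hw, hp, h1, chiFour_of_mod_four_eq_three h3]
      · have hc := (abs_le.1 (abs_chiFour_le_one d)).2
        simp only [hw, hp]
        norm_num
        nlinarith
    calc (1 + chiFour d) * Λ d / d = (1 + chiFour d) * Λ d * (1 / d) := by ring
      _ ≤ 2 * w d * (K / N) := by
        have := hw0 d
        gcongr
      _ = _ := by ring
  refine (Finset.sum_le_sum hterm).trans ?_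
  rw [← Finset.mul_sum]
  have hsub : Finset.Ioc (N / K) N ⊆ Finset.Ioc 0 N := Finset.Ioc_subset_Ioc_left (Nat.zero_le _)
  have hsum : ∑ d ∈ Finset.Ioc 0 N, w d ≤
      (((Finset.Icc 1 N).filter fun p => p.Prime ∧ p % 4 = 1).card : ℝ) * Real.log N +
        2 * √N * Real.log N := by
    rw [hw, Finset.sum_add_distrib]
    refine add_le_add (le_of_eq ?_) ?_
    · rw [← Finset.sum_filter, Finset.sum_const, nsmul_eq_mul]
      rfl
    · have h := Chebyshev.psi_sub_theta_le (x := (N : ℝ)) (by exact_mod_cast hNpos)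
      rw [Chebyshev.psi_sub_theta_eq_sum_not_prime, Nat.floor_natCast, Finset.sum_filter] at h
      convert h
  gcongr
  exact (Finset.sum_le_sum_of_subset_of_nonneg hsub fun d _ _ => hw0 d).trans hsum

/-- A Chebyshev-type lower bound for primes congruent to `1` modulo `4`. -/
theorem exists_le_card_primes_one_mod_four : ∃ c : ℝ, 0 < c ∧ ∃ N₀ : ℕ, ∀ N : ℕ, N₀ ≤ N →
    c * N / Real.log N ≤ ((Finset.Icc 1 N).filter fun p => p.Prime ∧ p % 4 = 1).card := by
  obtain ⟨K, hK⟩ := exists_nat_ge (Real.exp (4 * Real.log 4 + 22))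
  have hK0 : (0 : ℝ) < K := (Real.exp_pos _).trans_le hK
  have hKpos : 0 < K := by exact_mod_cast hK0
  have hlogK : 4 * Real.log 4 + 22 ≤ Real.log K := (Real.le_log_iff_exp_le hK0).2 hK
  have hlim : Filter.Tendsto (fun N : ℕ => Real.log N / (N : ℝ) ^ (1 / 2 : ℝ)) Filter.atTop
      (nhds 0) :=
    ((isLittleO_log_rpow_atTop (by norm_num)).tendsto_div_nhds_zero).comp
      tendsto_natCast_atTop_atTop
  obtain ⟨N₁, hN₁⟩ := Filter.eventually_atTop.1
    (hlim.eventually_lt_const (u := (1 / (4 * K) : ℝ)) (by positivity))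
  refine ⟨1 / (2 * K), by positivity, max N₁ (2 * K), fun N hN => ?_⟩
  have hN2 : 2 * K ≤ N := (le_max_right _ _).trans hN
  have hN0 : (0 : ℝ) < N := by exact_mod_cast (by omega : 0 < N)
  have hlogN : 0 < Real.log N := Real.log_pos (by exact_mod_cast (by omega : 1 < N))
  have hM : 0 < N / K := Nat.div_pos (by omega) hKpos
  have hM' : (0 : ℝ) < (N / K : ℕ) := by exact_mod_cast hM
  have h1 := log_div_sub_le_sum_one_add_chiFour hM (Nat.div_le_self N K)
  have h2 := sum_one_add_chiFour_le hKpos hN2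
  have h3 : Real.log K ≤ Real.log (N / (N / K : ℕ)) := by
    refine Real.log_le_log hK0 ?_
    rw [le_div_iff₀ hM']
    exact_mod_cast Nat.mul_div_le N K
  have h4 := hN₁ N ((le_max_left _ _).trans hN)
  rw [← Real.sqrt_eq_rpow] at h4
  have hs : 0 < √(N : ℝ) := Real.sqrt_pos.2 hN0
  rw [div_lt_div_iff₀ hs (by positivity)] at h4
  set c : ℝ := (((Finset.Icc 1 N).filter fun p => p.Prime ∧ p % 4 = 1).card : ℝ)
  have h5 : 2 ≤ 2 * K / N * (c * Real.log N + 2 * √N * Real.log N) := by linarith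
  rw [div_mul_eq_mul_div, le_div_iff₀ hN0] at h5
  have h6 : √(N : ℝ) * √N = N := Real.mul_self_sqrt hN0.le
  rw [div_le_iff₀ hlogN, div_mul_eq_mul_div,
    div_le_iff₀ (by positivity)]
  nlinarith

theorem exists_root_of_prime_one_mod_four {p : ℕ} (hp : p.Prime) (h : p % 4 = 1) :
    ∃ n, n < p ∧ p < 2 * n ∧ p ∣ n ^ 2 + 1 := by
  have : Fact p.Prime := ⟨hp⟩
  obtain ⟨y, hy⟩ := (ZMod.exists_sq_eq_neg_one_iff (p := p)).2 (by omega)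
  have hdvd : ∀ z : ZMod p, z * z = -1 → p ∣ z.val ^ 2 + 1 := by
    intro z hz
    rw [← ZMod.natCast_eq_zero_iff]
    push_cast
    rw [ZMod.natCast_zmod_val, pow_two, hz]
    ring
  have hlt := ZMod.val_lt y
  have hy0 : y ≠ 0 := by
    rintro rfl
    simp at hy
  have hneg : (-y).val = p - y.val := by
    have := NeZero.mk hy0
    exact ZMod.val_neg_of_ne_zero y
  rcases lt_or_ge p (2 * y.val) with h2 | h2
  · exact ⟨y.val, hlt, h2, hdvd y hy.symm⟩
  · refine ⟨(-y).val, ZMod.val_lt _, ?_, hdvd (-y) (by rw [neg_mul_neg, hy])⟩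
    rw [hneg]
    omega

theorem not_isPrimitiveDivisor_of_prime_dvd {p n : ℕ} (hp : p.Prime) (hn : n < p)
    (hpn : p < 2 * n) (hdvd : p ∣ n ^ 2 + 1) (d : ℕ) : ¬ IsPrimitiveDivisor d n := by
  rintro ⟨hd, hdn, hcop⟩
  obtain ⟨q, hq, hqd⟩ := Nat.exists_prime_and_dvd hd.ne'
  have hqn := hqd.trans hdn
  have hcop' : ∀ m, 1 ≤ m → m < n → ¬ q ∣ m ^ 2 + 1 := fun m h1 h2 h3 =>
    hq.one_lt.ne' (Nat.dvd_one.1 (hcop m h1 h2 ▸ Nat.dvd_gcd hqd h3))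
  rcases le_or_gt q n with hle | hlt
  · rcases hle.eq_or_lt with rfl | hlt
    · have : q ∣ 1 := (Nat.dvd_add_right (dvd_pow_self q two_ne_zero)).1 hqn
      exact hq.one_lt.ne' (Nat.dvd_one.1 this)
    · refine hcop' (n - q) (by omega) (by have := hq.pos; omega) ?_
      obtain ⟨k, rfl⟩ := Nat.exists_eq_add_of_lt hlt
      have e : (q + k + 1) ^ 2 + 1 = q * (q + 2 * (k + 1)) + ((k + 1) ^ 2 + 1) := by ring
      rw [e] at hqn
      have e2 : q + k + 1 - q = k + 1 := by omega
      rw [e2]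
      exact (Nat.dvd_add_right (dvd_mul_right _ _)).1 hqn
  · obtain ⟨m, hm⟩ := hdvd
    have hqp : q = p := by
      rcases hq.dvd_mul.1 (hm ▸ hqn) with h | h
      · exact (Nat.prime_dvd_prime_iff_eq hq hp).1 h
      · have hm0 : 0 < m := Nat.pos_of_ne_zero (by rintro rfl; simp at hm)
        have := Nat.le_of_dvd hm0 h
        nlinarith
    subst hqp
    refine hcop' (q - n) (by omega) (by omega) ?_
    obtain ⟨k, rfl⟩ := Nat.exists_eq_add_of_lt hn
    have e2 : n + k + 1 - n = k + 1 := by omega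
    rw [e2]
    have e : (k + 1) ^ 2 + 1 + (n + k + 1) * (2 * n) =
      (n ^ 2 + 1) + (n + k + 1) * (n + k + 1) := by ring
    have h7 : n + k + 1 ∣ (k + 1) ^ 2 + 1 + (n + k + 1) * (2 * n) := by
      rw [e]
      exact dvd_add hqn (dvd_mul_right _ _)
    exact (Nat.dvd_add_left (dvd_mul_right _ _)).1 h7

theorem eq_of_prime_dvd_sq_add_one {p q n : ℕ} (hp : p.Prime) (hq : q.Prime) (hnp : n < p)
    (hnq : n < q) (hn : 0 < n) (hpn : p ∣ n ^ 2 + 1) (hqn : q ∣ n ^ 2 + 1) : p = q := by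
  by_contra hne
  have h := Nat.le_of_dvd (by positivity)
    (((Nat.coprime_primes hp hq).2 hne).mul_dvd_of_dvd_of_dvd hpn hqn)
  nlinarith

theorem rho_add_card_primes_le (x : ℝ) :
    rho x + ((Finset.Icc 1 ⌊x⌋₊).filter fun p => p.Prime ∧ p % 4 = 1).card ≤ ⌊x⌋₊ - 1 := by
  set N := ⌊x⌋₊
  have hroot : ∀ p : ℕ, ∃ n, p.Prime ∧ p % 4 = 1 → n < p ∧ p < 2 * n ∧ p ∣ n ^ 2 + 1 := by
    intro p
    by_cases h : p.Prime ∧ p % 4 = 1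
    · obtain ⟨n, hn⟩ := exists_root_of_prime_one_mod_four h.1 h.2
      exact ⟨n, fun _ => hn⟩
    · exact ⟨0, fun h' => absurd h' h⟩
  choose r hr using hroot
  have hcard : ((Finset.Icc 1 N).filter fun p => p.Prime ∧ p % 4 = 1).card ≤
      ((Finset.Icc 2 N).filter fun n => ¬ ∃ d : ℕ, IsPrimitiveDivisor d n).card := by
    refine Finset.card_le_card_of_injOn r ?_ ?_
    · intro p hp
      simp only [Finset.coe_filter, Finset.mem_Icc, Set.mem_ofPred_eq] at hp ⊢
      obtain ⟨h1, h2, h3⟩ := hr p hp.2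
      have := hp.2.1.two_le
      refine ⟨⟨by omega, by omega⟩, ?_⟩
      rintro ⟨d, hd⟩
      exact not_isPrimitiveDivisor_of_prime_dvd hp.2.1 h1 h2 h3 d hd
    · intro p hp q hq hpq
      simp only [Finset.coe_filter, Finset.mem_Icc, Set.mem_ofPred_eq] at hp hq
      obtain ⟨h1, h2, h3⟩ := hr p hp.2
      obtain ⟨h1', h2', h3'⟩ := hr q hq.2
      rw [← hpq] at h1' h3'
      exact eq_of_prime_dvd_sq_add_one hp.2.1 hq.2.1 h1 h1' (by omega) h3 h3'
  have htot := Finset.card_filter_add_card_filter_not (s := Finset.Icc 2 N)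
    (fun n => ∃ d : ℕ, IsPrimitiveDivisor d n)
  rw [Nat.card_Icc] at htot
  change ((Finset.Icc 2 N).filter fun n => ∃ d : ℕ, IsPrimitiveDivisor d n).card + _ ≤ N - 1
  omega

theorem stmt_5 :
    ∃ C : ℝ, C > 0 ∧ ∃ x₀ : ℝ, ∀ x : ℝ, x ≥ x₀ →
      (rho x : ℝ) < x - C * x / Real.log x := by
  obtain ⟨c, hc, N₀, h⟩ := exists_le_card_primes_one_mod_four
  refine ⟨c / 2, by positivity, max (N₀ + 1) 3, fun x hx => ?_⟩
  have hx1 : (N₀ : ℝ) + 1 ≤ x := (le_max_left _ _).trans hx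
  have hx3 : (3 : ℝ) ≤ x := (le_max_right _ _).trans hx
  have hN0 : N₀ ≤ ⌊x⌋₊ := Nat.le_floor (by linarith)
  have hN3 : 3 ≤ ⌊x⌋₊ := Nat.le_floor (by exact_mod_cast hx3)
  have hN3' : (3 : ℝ) ≤ ⌊x⌋₊ := by exact_mod_cast hN3
  have hle : (⌊x⌋₊ : ℝ) ≤ x := Nat.floor_le (by linarith)
  have hlt := Nat.lt_floor_add_one x
  have hcard := h _ hN0
  have hrho : (rho x : ℝ) +
      ((Finset.Icc 1 ⌊x⌋₊).filter fun p => p.Prime ∧ p % 4 = 1).card + 1 ≤ ⌊x⌋₊ := by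
    have := rho_add_card_primes_le x
    exact_mod_cast (by omega :
      rho x + ((Finset.Icc 1 ⌊x⌋₊).filter fun p => p.Prime ∧ p % 4 = 1).card + 1 ≤ ⌊x⌋₊)
  have hlog : 0 < Real.log ⌊x⌋₊ := Real.log_pos (by linarith)
  have hmono : c / 2 * x / Real.log x ≤ c * ⌊x⌋₊ / Real.log ⌊x⌋₊ := by
    refine div_le_div₀ (by positivity) ?_ hlog (Real.log_le_log (by linarith) hle)
    nlinarith
  linarith
end
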